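/- arXiv:math/0606428 — 2 statements merged into one kernel-verified Lean document; each statement's English description precedes it below -/
import Mathlib

section
/- Let z : ℝ × [0,T) → ℂ \ {0} be a smooth solution of the equivariant flow (*), 2π-periodic and regular in φ for each t, whose initial curve is starshaped (⟨ν,e_r⟩(·,0) > 0). Then for every real p ≥ 2 the quantity m := r^{−p}⟨ν,e_r⟩ satisfies the uniform lower bound m(φ,t) ≥ min_{ψ ∈ [0,2π]} m(ψ,0) > 0 for all φ ∈ ℝ and all t ∈ [0,T); in particular there exists ε_p > 0 with r^{−p}⟨ν,e_r⟩ ≥ ε_p throughout the evolution. -/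
open Real Set

/-- Euclidean inner product on ℂ ≅ ℝ²: ⟨a,b⟩ = Re(conj a · b). -/
noncomputable def ip (a b : ℂ) : ℝ := a.re * b.re + a.im * b.im

/-- Outward unit normal ν = (∂_φ v − i ∂_φ u)/√g of a regular curve z = u + iv. -/
noncomputable def nu (z : ℝ → ℂ) (φ : ℝ) : ℂ :=
  (‖deriv z φ‖)⁻¹ • (⟨(deriv z φ).im, -(deriv z φ).re⟩ : ℂ)

/-- Curvature k = (u'v'' − v'u'')/g^{3/2}. -/
noncomputable def curv (z : ℝ → ℂ) (φ : ℝ) : ℝ :=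
  ((deriv z φ).re * (deriv (deriv z) φ).im -
    (deriv z φ).im * (deriv (deriv z) φ).re) / ‖deriv z φ‖ ^ 3

/-- f = k + (n−1)⟨z,ν⟩/|z|². -/
noncomputable def fq (n : ℕ) (z : ℝ → ℂ) (φ : ℝ) : ℝ :=
  curv z φ + ((n : ℝ) - 1) * ip (z φ) (nu z φ) / ‖z φ‖ ^ 2

/-- Tangential Laplacian Δh = (1/√g)∂_φ(∂_φ h/√g) along the curve z. -/
noncomputable def lap (z : ℝ → ℂ) (h : ℝ → ℝ) (φ : ℝ) : ℝ :=
  (deriv (fun ψ => deriv h ψ / ‖deriv z ψ‖) φ) / ‖deriv z φ‖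

/-- ⟨ν, e_r⟩ = ⟨z,ν⟩/|z|. -/
noncomputable def ner (z : ℝ → ℂ) (φ : ℝ) : ℝ := ip (z φ) (nu z φ) / ‖z φ‖

/-- Signed area of the parallelogram spanned by `a` and `b`. -/
noncomputable def wedge (a b : ℂ) : ℝ := a.re * b.im - a.im * b.re

/-- The inequality `pointwise_ineq` in coordinates relative to the velocity. -/
theorem frame_ineq {b N x y c d e h : ℝ} (hb : 3 ≤ b) (hN : 0 ≤ N) (hy : y < 0)
    (h1 : (x * d - y * c) / (-y) - c - b * (x / (x ^ 2 + y ^ 2)) = 0)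
    (h2 : 0 ≤ (d + (x * h - y * e)) / (-y) - ((x * d - y * c) / (-y)) ^ 2
      - ((c ^ 2 + d ^ 2 + e) - 2 * c ^ 2)
      - b * ((1 + x * c + y * d) / (x ^ 2 + y ^ 2) - 2 * (x / (x ^ 2 + y ^ 2)) ^ 2))
    {F F1 : ℝ} (hF : F = d - N * y / (x ^ 2 + y ^ 2))
    (hF1 : F1 = h - 4 * c * d + N * ((x * d - y * c + 2 * c * y) / (x ^ 2 + y ^ 2)
      + 2 * x * y / (x ^ 2 + y ^ 2) ^ 2)) :
    0 < (-F + (F1 * x + F * (x * c + y * d))) / (-y) - (-F * d)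
      - b * (F * y / (x ^ 2 + y ^ 2)) := by
  have hy0 : y ≠ 0 := hy.ne
  have hR : 0 < x ^ 2 + y ^ 2 := by nlinarith [sq_nonneg x, mul_pos_of_neg_of_neg hy hy]
  have hx : x * (d + b * y / (x ^ 2 + y ^ 2)) = 0 := by
    have : x * (d + b * y / (x ^ 2 + y ^ 2)) = -y * ((x * d - y * c) / (-y) - c
      - b * (x / (x ^ 2 + y ^ 2))) := by
      field_simp
      ring
    rw [this, h1, mul_zero]
  refine h2.trans_lt (sub_pos.1 ?_)
  subst hF hF1
  rcases mul_eq_zero.1 hx with rfl | hd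
  · have hy2 : 0 < y ^ 2 := by positivity
    have hpos : 0 < (d + 1 / y) ^ 2 + (b - 1 + N * (b - 1)) / y ^ 2 := by
      have : 0 < b - 1 + N * (b - 1) := by nlinarith
      positivity
    refine hpos.trans_eq ?_
    field_simp
    ring
  · obtain rfl : d = -(b * y / (x ^ 2 + y ^ 2)) := by linarith
    have hpos : 0 < (b * (b - 3) * x ^ 2 + b * (b - 1) * y ^ 2
        + N * ((b - 3) * x ^ 2 + (b - 1) * y ^ 2)) / (x ^ 2 + y ^ 2) ^ 2 := by
      have hy2 : 0 < y ^ 2 := by positivity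
      have h3 : 0 ≤ b - 3 := by linarith
      have h4 : 0 < b - 1 := by linarith
      have h5 : 0 < b := by linarith
      positivity
    refine hpos.trans_eq ?_
    field_simp
    ring

theorem frame_coords (z w : ℂ) (hw : w ≠ 0) : ∃ a b : ℝ, z = w * ⟨a, b⟩ :=
  ⟨(z / w).re, (z / w).im, by rw [Complex.eta]; field_simp⟩

set_option maxHeartbeats 1000000 in
/-- At a spatial critical point of the logarithmic quotient with nonnegative second derivative, the
time derivative is positive. The arguments `z`, `z1`, `z2`, `z3` are the position and its
first three derivatives in `φ`, and `W`, `W1` are the time derivatives of `z` and `z1`. -/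
theorem pointwise_ineq {b N : ℝ} (hb : 3 ≤ b) (hN : 0 ≤ N) {z z1 z2 z3 : ℂ}
    (hP : 0 < wedge z z1)
    (h1 : wedge z z2 / wedge z z1 - ip z1 z2 / ip z1 z1 - b * (ip z z1 / ip z z) = 0)
    (h2 : 0 ≤ ((wedge z1 z2 + wedge z z3) / wedge z z1 - (wedge z z2 / wedge z z1) ^ 2)
      - ((ip z2 z2 + ip z1 z3) / ip z1 z1 - 2 * (ip z1 z2 / ip z1 z1) ^ 2)
      - b * ((ip z1 z1 + ip z z2) / ip z z - 2 * (ip z z1 / ip z z) ^ 2))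
    {F F1 : ℝ} {W W1 : ℂ}
    (hF : F = wedge z1 z2 / ip z1 z1 ^ 2 + N * (wedge z z1 / (ip z1 z1 * ip z z)))
    (hF1 : F1 = wedge z1 z3 / ip z1 z1 ^ 2 - 4 * wedge z1 z2 * ip z1 z2 / ip z1 z1 ^ 3
      + N * (wedge z z2 / (ip z1 z1 * ip z z) - wedge z z1 * (2 * ip z1 z2 * ip z z
        + ip z1 z1 * (2 * ip z z1)) / (ip z1 z1 * ip z z) ^ 2))
    (hW : W = F * (Complex.I * z1)) (hW1 : W1 = F1 * (Complex.I * z1) + F * (Complex.I * z2)) :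
    0 < (wedge W z1 + wedge z W1) / wedge z z1 - ip z1 W1 / ip z1 z1 - b * (ip z W / ip z z) := by
  have hz1 : z1 ≠ 0 := by rintro rfl; simp [wedge] at hP
  obtain ⟨x, y, rfl⟩ := frame_coords z z1 hz1
  obtain ⟨c, d, rfl⟩ := frame_coords z2 z1 hz1
  obtain ⟨e, h, rfl⟩ := frame_coords z3 z1 hz1
  obtain ⟨g, hg⟩ : ∃ g, g = ip z1 z1 := ⟨_, rfl⟩
  have hg0 : 0 < g := by
    rw [hg, ip, ← Complex.normSq_apply]; exact Complex.normSq_pos.2 hz1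
  have e1 : wedge (z1 * ⟨x, y⟩) z1 = g * (-y) := by rw [hg]; simp [wedge, ip]; ring
  have e2 : wedge (z1 * ⟨x, y⟩) (z1 * ⟨c, d⟩) = g * (x * d - y * c) := by
    rw [hg]; simp [wedge, ip]; ring
  have e3 : wedge (z1 * ⟨x, y⟩) (z1 * ⟨e, h⟩) = g * (x * h - y * e) := by
    rw [hg]; simp [wedge, ip]; ring
  have e4 : wedge z1 (z1 * ⟨c, d⟩) = g * d := by rw [hg]; simp [wedge, ip]; ring
  have e5 : wedge z1 (z1 * ⟨e, h⟩) = g * h := by rw [hg]; simp [wedge, ip]; ring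
  have e6 : ip z1 (z1 * ⟨c, d⟩) = g * c := by rw [hg]; simp [ip]; ring
  have e7 : ip z1 (z1 * ⟨e, h⟩) = g * e := by rw [hg]; simp [ip]; ring
  have e8 : ip (z1 * ⟨x, y⟩) z1 = g * x := by rw [hg]; simp [ip]; ring
  have e9 : ip (z1 * ⟨x, y⟩) (z1 * ⟨x, y⟩) = g * (x ^ 2 + y ^ 2) := by rw [hg]; simp [ip]; ring
  have e10 : ip (z1 * ⟨x, y⟩) (z1 * ⟨c, d⟩) = g * (x * c + y * d) := by rw [hg]; simp [ip]; ring
  have e11 : ip (z1 * ⟨c, d⟩) (z1 * ⟨c, d⟩) = g * (c ^ 2 + d ^ 2) := by rw [hg]; simp [ip]; ring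
  have e12 : wedge W z1 = g * (-F) := by rw [hg, hW]; simp [wedge, ip]; ring
  have e13 : wedge (z1 * ⟨x, y⟩) W1 = g * (F1 * x + F * (x * c + y * d)) := by
    rw [hg, hW1]; simp [wedge, ip]; ring
  have e14 : ip z1 W1 = g * (-F * d) := by rw [hg, hW1]; simp [ip]; ring
  have e15 : ip (z1 * ⟨x, y⟩) W = g * (F * y) := by rw [hg, hW]; simp [ip]; ring
  rw [e1] at hP
  have hy : y < 0 := by linarith [pos_of_mul_pos_right hP hg0.le]
  have hy0 : y ≠ 0 := hy.ne
  have hR : 0 < x ^ 2 + y ^ 2 := by nlinarith [sq_nonneg x, mul_pos_of_neg_of_neg hy hy]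
  rw [e1, e2, e6, e8, e9, ← hg] at h1
  rw [e1, e2, e3, e4, e6, e7, e8, e9, e10, e11, ← hg] at h2
  rw [e4, e1, e9, ← hg] at hF
  rw [e1, e2, e4, e5, e6, e8, e9, ← hg] at hF1
  rw [e12, e13, e1, e14, e15, e9, ← hg]
  have key := frame_ineq (e := e) (h := h) (x := x) (c := c) (d := d) (F := g * F) (F1 := g * F1)
    hb hN hy ?_ ?_ ?_ ?_
  · have : (g * -F + g * (F1 * x + F * (x * c + y * d))) / (g * -y) - g * (-F * d) / g
      - b * (g * (F * y) / (g * (x ^ 2 + y ^ 2))) = g⁻¹ * ((-(g * F) + (g * F1 * x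
      + g * F * (x * c + y * d))) / (-y) - (-(g * F) * d)
      - b * (g * F * y / (x ^ 2 + y ^ 2))) := by
      field_simp
    rw [this]; exact mul_pos (inv_pos.2 hg0) key
  · rw [← h1]; field_simp
  · refine h2.trans_eq ?_; field_simp
    ring
  · rw [hF]; field_simp
    ring
  · rw [hF1]; field_simp
    ring

theorem ip_self (a : ℂ) : ip a a = ‖a‖ ^ 2 := by
  rw [← Complex.normSq_eq_norm_sq, Complex.normSq_apply, ip]

theorem HasDerivAt.ip {f g : ℝ → ℂ} {f' g' : ℂ} {x : ℝ} (hf : HasDerivAt f f' x)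
    (hg : HasDerivAt g g' x) :
    HasDerivAt (fun y => _root_.ip (f y) (g y)) (_root_.ip f' (g x) + _root_.ip (f x) g') x := by
  have h1 := Complex.reCLM.hasFDerivAt.comp_hasDerivAt x hf
  have h2 := Complex.imCLM.hasFDerivAt.comp_hasDerivAt x hf
  have h3 := Complex.reCLM.hasFDerivAt.comp_hasDerivAt x hg
  have h4 := Complex.imCLM.hasFDerivAt.comp_hasDerivAt x hg
  refine ((h1.mul h3).add (h2.mul h4)).congr_deriv ?_
  simp [_root_.ip]; ring

theorem HasDerivAt.wedge {f g : ℝ → ℂ} {f' g' : ℂ} {x : ℝ} (hf : HasDerivAt f f' x)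
    (hg : HasDerivAt g g' x) :
    HasDerivAt (fun y => _root_.wedge (f y) (g y))
      (_root_.wedge f' (g x) + _root_.wedge (f x) g') x := by
  have h1 := Complex.reCLM.hasFDerivAt.comp_hasDerivAt x hf
  have h2 := Complex.imCLM.hasFDerivAt.comp_hasDerivAt x hf
  have h3 := Complex.reCLM.hasFDerivAt.comp_hasDerivAt x hg
  have h4 := Complex.imCLM.hasFDerivAt.comp_hasDerivAt x hg
  refine ((h1.mul h4).sub (h2.mul h3)).congr_deriv ?_
  simp [_root_.wedge]; ring

theorem wedge_self (a : ℂ) : wedge a a = 0 := by simp [wedge, mul_comm]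

theorem ip_comm (a b : ℂ) : ip a b = ip b a := by simp [ip, mul_comm]

/-- The logarithm of `|z|^(-b) ⟨z, ν⟩` in terms of position `z` and velocity `w`. -/
noncomputable def logQuot (b : ℝ) (z w : ℂ) : ℝ :=
  log (wedge z w) - log (ip w w) / 2 - b * (log (ip z z) / 2)

theorem ip_self_pos_of_wedge_pos {a b : ℂ} (h : 0 < wedge a b) : 0 < ip a a ∧ 0 < ip b b := by
  constructor
  · have : a ≠ 0 := by rintro rfl; simp [wedge] at h
    rw [ip_self]; positivity
  · have : b ≠ 0 := by rintro rfl; simp [wedge] at h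
    rw [ip_self]; positivity

theorem HasDerivAt.logQuot (b : ℝ) {f g : ℝ → ℂ} {f' g' : ℂ} {x : ℝ} (hf : HasDerivAt f f' x)
    (hg : HasDerivAt g g' x) (h : 0 < _root_.wedge (f x) (g x)) :
    HasDerivAt (fun y => _root_.logQuot b (f y) (g y))
      ((_root_.wedge f' (g x) + _root_.wedge (f x) g') / _root_.wedge (f x) (g x)
        - _root_.ip (g x) g' / _root_.ip (g x) (g x)
        - b * (_root_.ip (f x) f' / _root_.ip (f x) (f x))) x := by
  obtain ⟨h1, h2⟩ := ip_self_pos_of_wedge_pos h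
  refine ((((hf.wedge hg).log h.ne').sub (((hg.ip hg).log h2.ne').div_const 2)).sub
    ((((hf.ip hf).log h1.ne').div_const 2).const_mul b)).congr_deriv ?_
  rw [ip_comm g', ip_comm f']
  ring

/-- Second derivative test, necessary condition. -/
theorem second_deriv_nonneg_of_isMin {f f' : ℝ → ℝ} {f'' x : ℝ}
    (hf : ∀ y, HasDerivAt f (f' y) y) (hf' : HasDerivAt f' f'' x) (hmin : ∀ y, f x ≤ f y) :
    f' x = 0 ∧ 0 ≤ f'' := by
  have h0 : f' x = 0 :=
    IsLocalMin.hasDerivAt_eq_zero (Filter.Eventually.of_forall hmin) (hf x)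
  refine ⟨h0, ?_⟩
  by_contra! hneg
  have hd : deriv f = f' := funext fun y => (hf y).deriv
  have hmax : IsLocalMax f x := by
    refine isLocalMax_of_deriv_deriv_neg ?_ ?_ (hf x).continuousAt
    · rwa [hd, hf'.deriv]
    · rw [hd, h0]
  have hc : f =ᶠ[nhds x] fun _ => f x := by
    filter_upwards [hmax] with y hy using le_antisymm hy (hmin y)
  have := hc.deriv.deriv.eq_of_nhds
  rw [hd, hf'.deriv] at this
  simp at this
  exact hneg.ne this

theorem hasDerivAt_fst_line {E : Type*} [NormedAddCommGroup E] [NormedSpace ℝ E] {Z : ℝ × ℝ → E}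
    (hZ : Differentiable ℝ Z) (t φ : ℝ) :
    HasDerivAt (fun s => Z (s, φ)) (fderiv ℝ Z (t, φ) (1, 0)) t :=
  (hZ (t, φ)).hasFDerivAt.comp_hasDerivAt t ((hasDerivAt_id t).prodMk (hasDerivAt_const t φ))

theorem hasDerivAt_snd_line {E : Type*} [NormedAddCommGroup E] [NormedSpace ℝ E] {Z : ℝ × ℝ → E}
    (hZ : Differentiable ℝ Z) (t φ : ℝ) :
    HasDerivAt (fun ψ => Z (t, ψ)) (fderiv ℝ Z (t, φ) (0, 1)) φ :=
  (hZ (t, φ)).hasFDerivAt.comp_hasDerivAt φ ((hasDerivAt_const φ t).prodMk (hasDerivAt_id φ))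

/-- Symmetry of the mixed partial derivatives. -/
theorem hasDerivAt_deriv_comm {z : ℝ → ℝ → ℂ}
    (hsm : ContDiff ℝ (⊤ : ℕ∞) (fun p : ℝ × ℝ => z p.1 p.2)) (t φ : ℝ) :
    HasDerivAt (fun s => deriv (z s) φ) (deriv (fun ψ => deriv (fun s => z s ψ) t) φ) t := by
  obtain ⟨Z, hZ⟩ : ∃ Z : ℝ × ℝ → ℂ, Z = fun p => z p.1 p.2 := ⟨_, rfl⟩
  rw [← hZ] at hsm
  have hd : Differentiable ℝ Z := hsm.differentiable (by simp)
  have hd2 : Differentiable ℝ (fderiv ℝ Z) :=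
    (hsm.fderiv_right (m := 1) (by norm_cast)).differentiable (by simp)
  obtain rfl : z = fun s ψ => Z (s, ψ) := by rw [hZ]
  have h1 (s ψ : ℝ) : deriv (fun ψ => Z (s, ψ)) ψ = fderiv ℝ Z (s, ψ) (0, 1) :=
    (hasDerivAt_snd_line hd s ψ).deriv
  have h2 (s ψ : ℝ) : deriv (fun s => Z (s, ψ)) s = fderiv ℝ Z (s, ψ) (1, 0) :=
    (hasDerivAt_fst_line hd s ψ).deriv
  have h3 := (hasDerivAt_snd_line hd2 t φ).clm_apply (hasDerivAt_const φ ((1, 0) : ℝ × ℝ))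
  have h4 := (hasDerivAt_fst_line hd2 t φ).clm_apply (hasDerivAt_const t ((0, 1) : ℝ × ℝ))
  have hsymm : IsSymmSndFDerivAt ℝ Z (t, φ) :=
    hsm.contDiffAt.isSymmSndFDerivAt (by simp; norm_cast)
  simp_rw [h1, h2]
  rw [h3.deriv]
  refine h4.congr_deriv ?_
  rw [map_zero, add_zero, add_zero, hsymm.eq]

theorem continuous_deriv_snd {z : ℝ → ℝ → ℂ}
    (hsm : ContDiff ℝ (⊤ : ℕ∞) (fun p : ℝ × ℝ => z p.1 p.2)) :
    Continuous (fun p : ℝ × ℝ => deriv (z p.1) p.2) := by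
  have h1 (p : ℝ × ℝ) : deriv (z p.1) p.2 = fderiv ℝ (fun p : ℝ × ℝ => z p.1 p.2) p (0, 1) :=
    (hasDerivAt_snd_line (hsm.differentiable (by simp)) p.1 p.2).deriv
  simp_rw [h1]
  exact (hsm.continuous_fderiv (by simp)).clm_apply continuous_const

theorem ner_eq (z : ℝ → ℂ) (φ : ℝ) :
    ner z φ = wedge (z φ) (deriv z φ) / (‖deriv z φ‖ * ‖z φ‖) := by
  simp only [ner, nu, ip, wedge, Complex.real_smul, Complex.mul_re, Complex.mul_im,
    Complex.ofReal_re, Complex.ofReal_im]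
  by_cases h : ‖deriv z φ‖ = 0
  · simp [h]
  by_cases h' : ‖z φ‖ = 0
  · simp [h']
  field_simp
  ring

theorem log_rpow_mul_ner {p : ℝ} {z : ℝ → ℂ} {φ : ℝ} (h : 0 < wedge (z φ) (deriv z φ)) :
    log (‖z φ‖ ^ (-p) * ner z φ) = logQuot (p + 1) (z φ) (deriv z φ) := by
  obtain ⟨h1, h2⟩ := ip_self_pos_of_wedge_pos h
  rw [ip_self, sq_pos_iff] at h1 h2
  replace h1 : 0 < ‖z φ‖ := h1.symm.lt_of_le (norm_nonneg _)
  replace h2 : 0 < ‖deriv z φ‖ := h2.symm.lt_of_le (norm_nonneg _)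
  rw [ner_eq, log_mul (by positivity) (by positivity), log_rpow h1,
    log_div (by positivity) (by positivity), log_mul (by positivity) (by positivity), logQuot,
    ip_self, ip_self, log_pow, log_pow]
  push_cast
  ring

theorem wedge_pos_of_pos {p : ℝ} {z : ℝ → ℂ} {φ : ℝ} (h : 0 < ‖z φ‖ ^ (-p) * ner z φ) :
    0 < wedge (z φ) (deriv z φ) := by
  rw [ner_eq] at h
  have h' := pos_of_mul_pos_right h (by positivity)
  by_contra! hc
  exact h'.not_ge (div_nonpos_of_nonpos_of_nonneg hc (by positivity))

theorem flow_eq {n : ℕ} {z : ℝ → ℂ} {φ : ℝ} :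
    -(fq n z φ) • nu z φ = ((wedge (deriv z φ) (deriv (deriv z) φ) / ip (deriv z φ) (deriv z φ) ^ 2
      + ((n : ℝ) - 1) * (wedge (z φ) (deriv z φ) / (ip (deriv z φ) (deriv z φ) * ip (z φ) (z φ)))
          : ℝ) : ℂ) * (Complex.I * deriv z φ) := by
  have hcr : ip (z φ) (nu z φ) = wedge (z φ) (deriv z φ) / ‖deriv z φ‖ := by
    simp only [nu, ip, wedge, Complex.real_smul, Complex.mul_re, Complex.mul_im,
      Complex.ofReal_re, Complex.ofReal_im]
    ring
  have hnu : nu z φ = ((‖deriv z φ‖⁻¹ : ℝ) : ℂ) * (-(Complex.I * deriv z φ)) := by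
    apply Complex.ext <;> simp [nu]
  rw [hnu, fq, hcr, curv, ip_self, ip_self, ← wedge, Complex.real_smul, ← mul_assoc,
    ← Complex.ofReal_mul, mul_neg, ← neg_mul, ← Complex.ofReal_neg]
  congr 2
  ring

theorem logQuot_deriv_pos {n : ℕ} (hn : 1 ≤ n) {b : ℝ} (hb : 3 ≤ b) {z : ℝ → ℝ → ℂ}
    (hsm : ContDiff ℝ (⊤ : ℕ∞) (fun p : ℝ × ℝ => z p.1 p.2)) {t φ : ℝ}
    (hflow : ∀ φ, deriv (fun s => z s φ) t = -(fq n (z t) φ) • nu (z t) φ)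
    (hpos : ∀ ψ, 0 < wedge (z t ψ) (deriv (z t) ψ))
    (hmin : ∀ ψ, logQuot b (z t φ) (deriv (z t) φ) ≤ logQuot b (z t ψ) (deriv (z t) ψ)) :
    ∃ D > 0, HasDerivAt (fun s => logQuot b (z s φ) (deriv (z s) φ)) D t := by
  have hzt : ContDiff ℝ (⊤ : ℕ∞) (z t) := hsm.comp (contDiff_const.prodMk contDiff_id)
  have c1 : ContDiff ℝ (⊤ : ℕ∞) (deriv (z t)) := (contDiff_infty_iff_deriv.1 hzt).2
  have c2 : ContDiff ℝ (⊤ : ℕ∞) (deriv (deriv (z t))) := (contDiff_infty_iff_deriv.1 c1).2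
  have d0 (ψ) : HasDerivAt (z t) (deriv (z t) ψ) ψ :=
    (hzt.differentiable (by simp) ψ).hasDerivAt
  have d1 (ψ) : HasDerivAt (deriv (z t)) (deriv (deriv (z t)) ψ) ψ :=
    (c1.differentiable (by simp) ψ).hasDerivAt
  have d2 (ψ) : HasDerivAt (deriv (deriv (z t))) (deriv (deriv (deriv (z t))) ψ) ψ :=
    (c2.differentiable (by simp) ψ).hasDerivAt
  obtain ⟨hρ, hg⟩ := ip_self_pos_of_wedge_pos (hpos φ)
  have hdt : HasDerivAt (fun s => z s φ) (deriv (fun s => z s φ) t) t :=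
    ((hsm.comp (contDiff_id.prodMk contDiff_const)).differentiable (by simp) t).hasDerivAt
  have hdt1 := hasDerivAt_deriv_comm hsm t φ
  refine ⟨_, ?_, HasDerivAt.logQuot b hdt hdt1 (hpos φ)⟩
  have hL1 (ψ) := HasDerivAt.logQuot b (d0 ψ) (d1 ψ) (hpos ψ)
  simp only [wedge_self, zero_add] at hL1
  have hL2 := ((((d0 φ).wedge (d2 φ)).div ((d0 φ).wedge (d1 φ)) (hpos φ).ne').sub
    (((d1 φ).ip (d2 φ)).div ((d1 φ).ip (d1 φ)) hg.ne')).sub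
    ((((d0 φ).ip (d1 φ)).div ((d0 φ).ip (d0 φ)) hρ.ne').const_mul b)
  obtain ⟨e1, e2⟩ := second_deriv_nonneg_of_isMin hL1 hL2 hmin
  have hF := (((d1 φ).wedge (d2 φ)).div (((d1 φ).ip (d1 φ)).pow 2) (pow_ne_zero 2 hg.ne')).add
    ((((d0 φ).wedge (d1 φ)).div (((d1 φ).ip (d1 φ)).mul ((d0 φ).ip (d0 φ)))
      (mul_pos hg hρ).ne').const_mul ((n : ℝ) - 1))
  have hW := hF.ofReal_comp.mul ((d1 φ).const_mul Complex.I)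
  have hWeq := (funext fun ψ => (hflow ψ).trans flow_eq : (fun ψ => deriv (fun s => z s ψ) t) = _)
  refine pointwise_ineq (N := (n : ℝ) - 1) hb (by simpa using hn) (hpos φ) e1 ?_ rfl rfl
    (congrFun hWeq φ) ?_ (z3 := deriv (deriv (deriv (z t))) φ)
  · refine e2.trans_eq ?_
    simp only [wedge_self, zero_add]
    simp only [ip_comm (deriv (deriv (z t)) φ) (deriv (z t) φ), ip_comm (deriv (z t) φ) (z t φ)]
    have := (hpos φ).ne'
    field_simp
    ring
  · rw [hWeq]
    refine hW.deriv.trans (congrArg₂ (· + ·) (congrArg (fun r : ℝ => (r : ℂ) * _) ?_) rfl)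
    simp only [wedge_self, zero_add]
    simp only [ip_comm (deriv (deriv (z t)) φ) (deriv (z t) φ), ip_comm (deriv (z t) φ) (z t φ),
      Pi.pow_apply, Pi.mul_apply]
    field_simp
    ring

/-- A function, periodic in space, which exceeds a level initially cannot touch it from above if at
every first touching point its time derivative is positive. -/
theorem le_of_first_touch {m : ℝ → ℝ → ℝ} {T c L : ℝ} (hL : 0 < L)
    (hcont : ContinuousOn (fun q : ℝ × ℝ => m q.1 q.2) (Ico 0 T ×ˢ univ))
    (hper : ∀ t, Function.Periodic (m t) L) (h0 : ∀ φ, c < m 0 φ)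
    (htouch : ∀ t ∈ Ioo 0 T, ∀ φ, (∀ ψ, m t φ ≤ m t ψ) → m t φ = c →
      ¬ ∀ s ∈ Ico 0 t, c < m s φ) :
    ∀ t ∈ Ico 0 T, ∀ φ, c < m t φ := by
  intro t₀ ht₀ φ₀
  by_contra! hlt
  have hred (t φ : ℝ) : ∃ ψ ∈ Icc 0 L, m t φ = m t ψ := by
    obtain ⟨ψ, hψ, h⟩ := (hper t).exists_mem_Ico₀ hL φ
    exact ⟨ψ, Ico_subset_Icc_self hψ, h⟩
  have hsub : Icc 0 t₀ ×ˢ Icc 0 L ⊆ Ico 0 T ×ˢ (univ : Set ℝ) :=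
    prod_mono (Icc_subset_Ico_right ht₀.2) (subset_univ _)
  have hK : IsCompact ((Icc 0 t₀ ×ˢ Icc 0 L) ∩ (fun q : ℝ × ℝ => m q.1 q.2) ⁻¹' Iic c) :=
    (isCompact_Icc.prod isCompact_Icc).of_isClosed_subset
      ((hcont.mono hsub).preimage_isClosed_of_isClosed (isClosed_Icc.prod isClosed_Icc)
        isClosed_Iic) inter_subset_left
  obtain ⟨ψ₀, hψ₀, he⟩ := hred t₀ φ₀
  obtain ⟨⟨t, φ⟩, ⟨⟨ht, -⟩, hle⟩, hmin⟩ := hK.exists_isMinOn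
    ⟨(t₀, ψ₀), ⟨⟨⟨ht₀.1, le_rfl⟩, hψ₀⟩, he.symm.trans_le hlt⟩⟩ continuousOn_fst
  have htpos : 0 < t := by
    refine lt_of_le_of_ne ht.1 ?_
    rintro rfl
    exact (h0 φ).not_ge hle
  have hbefore : ∀ s ∈ Ico 0 t, ∀ ψ, c < m s ψ := by
    intro s hs ψ
    by_contra! hc
    obtain ⟨ψ', hψ', he'⟩ := hred s ψ
    have : t ≤ s := hmin (a := (s, ψ')) ⟨⟨⟨hs.1, hs.2.le.trans ht.2⟩, hψ'⟩, he'.symm.trans_le hc⟩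
    exact this.not_gt hs.2
  have htT : t ∈ Ioo 0 T := ⟨htpos, ht.2.trans_lt ht₀.2⟩
  have hge (ψ : ℝ) : c ≤ m t ψ := by
    have hcw : ContinuousWithinAt (fun s => m s ψ) (Iio t) t := by
      have h1 : ContinuousWithinAt (fun s => m s ψ) (Ico 0 T) t :=
        (hcont (t, ψ) ⟨⟨htpos.le, htT.2⟩, mem_univ _⟩).comp (f := fun s : ℝ => (s, ψ))
          (by fun_prop) fun s hs => ⟨hs, mem_univ _⟩
      exact (h1.continuousAt (Ico_mem_nhds htpos htT.2)).continuousWithinAt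
    refine ge_of_tendsto hcw.tendsto ?_
    filter_upwards [Ico_mem_nhdsLT htpos] with s hs using (hbefore s hs ψ).le
  have heq : m t φ = c := le_antisymm hle (hge φ)
  exact htouch t htT φ (fun ψ => heq.trans_le (hge ψ)) heq fun s hs => hbefore s hs φ

theorem HasDerivAt.exists_lt_left {f : ℝ → ℝ} {D t a : ℝ} (hf : HasDerivAt f D t) (hD : 0 < D)
    (ha : a < t) : ∃ s ∈ Ico a t, f s < f t := by
  have h1 : Filter.Tendsto (slope f t) (nhdsWithin t (Iio t)) (nhds D) :=
    (hasDerivAt_iff_tendsto_slope.1 hf).mono_left (nhdsWithin_mono _ fun x hx => ne_of_lt hx)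
  obtain ⟨s, hs, hs'⟩ := ((h1.eventually_const_lt hD).and (Ico_mem_nhdsLT ha)).exists
  refine ⟨s, hs', ?_⟩
  rw [slope_def_field] at hs
  by_contra! hc
  exact hs.not_ge (div_nonpos_of_nonneg_of_nonpos (sub_nonneg.2 hc) (sub_nonpos.2 hs'.2.le))

/-- For a starshaped initial curve and any real p ≥ 2, the quantity
m = r^{−p}⟨ν,e_r⟩ stays bounded below by its initial minimum, which is positive. -/
theorem starshaped_quantitative (n : ℕ) (hn : 1 ≤ n) (T : ℝ) (hT : 0 < T)
    (z : ℝ → ℝ → ℂ)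
    (hsm : ContDiff ℝ (⊤ : ℕ∞) (fun p : ℝ × ℝ => z p.1 p.2))
    (hper : ∀ t φ, z t (φ + 2 * π) = z t φ)
    (hreg : ∀ t ∈ Ico (0:ℝ) T, ∀ φ, deriv (z t) φ ≠ 0)
    (hnz : ∀ t ∈ Ico (0:ℝ) T, ∀ φ, z t φ ≠ 0)
    (hflow : ∀ t ∈ Ico (0:ℝ) T, ∀ φ,
      deriv (fun s => z s φ) t = -(fq n (z t) φ) • nu (z t) φ)
    (hstar : ∀ φ : ℝ, 0 < ner (z 0) φ)
    (p : ℝ) (hp : 2 ≤ p) :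
    0 < sInf ((fun ψ => ‖z 0 ψ‖ ^ (-p) * ner (z 0) ψ) '' Icc (0:ℝ) (2 * π)) ∧
    ∀ t ∈ Ico (0:ℝ) T, ∀ φ : ℝ,
      sInf ((fun ψ => ‖z 0 ψ‖ ^ (-p) * ner (z 0) ψ) '' Icc (0:ℝ) (2 * π)) ≤
        ‖z t φ‖ ^ (-p) * ner (z t) φ := by
  have hzc : Continuous fun q : ℝ × ℝ => z q.1 q.2 := hsm.continuous
  have hz1c := continuous_deriv_snd hsm
  have hcont : ContinuousOn (fun q : ℝ × ℝ => ‖z q.1 q.2‖ ^ (-p) * ner (z q.1) q.2)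
      (Ico 0 T ×ˢ univ) := by
    simp_rw [ner_eq, wedge]
    have hne : ∀ q ∈ Ico 0 T ×ˢ (univ : Set ℝ), ‖z q.1 q.2‖ ≠ 0 :=
      fun q hq => norm_ne_zero_iff.2 (hnz q.1 hq.1 q.2)
    refine (hzc.norm.continuousOn.rpow_const fun q hq => .inl (hne q hq)).mul
      (ContinuousOn.div (by fun_prop) (by fun_prop) fun q hq =>
        mul_ne_zero (norm_ne_zero_iff.2 (hreg q.1 hq.1 q.2)) (hne q hq))
  have hmper (t : ℝ) : Function.Periodic (fun φ => ‖z t φ‖ ^ (-p) * ner (z t) φ) (2 * π) := by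
    intro φ
    have : deriv (z t) (φ + 2 * π) = deriv (z t) φ := by
      rw [← deriv_comp_add_const, funext (hper t)]
    simp only [ner_eq, this, hper t φ]
  have h0T : (0 : ℝ) ∈ Ico 0 T := ⟨le_rfl, hT⟩
  have hm0 (ψ : ℝ) : 0 < ‖z 0 ψ‖ ^ (-p) * ner (z 0) ψ :=
    mul_pos (rpow_pos_of_pos (norm_pos_iff.2 (hnz 0 h0T ψ)) _) (hstar ψ)
  have hc0 : Continuous fun ψ => ‖z 0 ψ‖ ^ (-p) * ner (z 0) ψ :=
    hcont.comp_continuous (f := fun ψ : ℝ => ((0 : ℝ), ψ)) (by fun_prop) fun _ => ⟨h0T, mem_univ _⟩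
  have hcomp : IsCompact ((fun ψ => ‖z 0 ψ‖ ^ (-p) * ner (z 0) ψ) '' Icc (0 : ℝ) (2 * π)) :=
    isCompact_Icc.image hc0
  have hnonempty := (nonempty_Icc.2 two_pi_pos.le).image
    (fun ψ => ‖z 0 ψ‖ ^ (-p) * ner (z 0) ψ)
  have hSpos : 0 < sInf ((fun ψ => ‖z 0 ψ‖ ^ (-p) * ner (z 0) ψ) '' Icc (0 : ℝ) (2 * π)) := by
    obtain ⟨ψ, -, h⟩ := hcomp.sInf_mem hnonempty
    rw [← h]
    exact hm0 ψ
  refine ⟨hSpos, fun t ht φ => ?_⟩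
  by_contra! hlt
  obtain ⟨c, hc, hcS⟩ := exists_between (max_lt hlt hSpos)
  obtain ⟨hc1, hcpos⟩ := max_lt_iff.1 hc
  refine hc1.not_gt (le_of_first_touch two_pi_pos hcont hmper (fun ψ => ?_) ?_ t ht φ)
  · obtain ⟨ψ', hψ', h⟩ := (hmper 0).exists_mem_Ico₀ two_pi_pos ψ
    exact hcS.trans_le (
      (csInf_le hcomp.bddBelow ⟨ψ', Ico_subset_Icc_self hψ', rfl⟩).trans_eq h.symm)
  intro t ht φ hmin heq hbefore
  have hpos (ψ : ℝ) := hcpos.trans_le (heq.symm.trans_le (hmin ψ))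
  have hcr (ψ : ℝ) := wedge_pos_of_pos (hpos ψ)
  obtain ⟨D, hD, hd⟩ := logQuot_deriv_pos hn (b := p + 1) (by linarith) hsm
    (hflow t ⟨ht.1.le, ht.2⟩) hcr (φ := φ) fun ψ => by
      rw [← log_rpow_mul_ner (hcr φ), ← log_rpow_mul_ner (hcr ψ)]
      exact log_le_log (hpos φ) (hmin ψ)
  obtain ⟨s, hs, hlt⟩ := hd.exists_lt_left hD ht.1
  have hps := hcpos.trans (hbefore s hs)
  rw [← log_rpow_mul_ner (hcr φ), ← log_rpow_mul_ner (wedge_pos_of_pos hps)] at hlt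
  exact ((log_lt_log_iff hps (hpos φ)).1 hlt).not_ge (heq.trans_le (hbefore s hs).le)
end

section
/- Let z : ℝ × [0,T) → ℂ \ {0} be a smooth solution of the equivariant flow (*), 2π-periodic and regular in φ for each t. If the initial curve is austere, i.e. ⟨ν,e_r⟩(φ,0) > −1 for all φ, then ⟨ν,e_r⟩(φ,t) > −1 for all φ ∈ ℝ and all t ∈ [0,T). -/
open Real Set

/-- A function attaining a local minimum has nonnegative second derivative there. -/
theorem IsLocalMin.deriv_deriv_nonneg {f : ℝ → ℝ} {x : ℝ} (hf : IsLocalMin f x)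
    (hc : ContinuousAt f x) : 0 ≤ deriv (deriv f) x := by
  by_contra! h
  have hmax := isLocalMax_of_deriv_deriv_neg h hf.deriv_eq_zero hc
  have heq : f =ᶠ[nhds x] fun _ => f x := by
    filter_upwards [hf, hmax] with y h1 h2 using le_antisymm h2 h1
  have := heq.deriv.deriv_eq
  simp at this
  exact h.ne this

/-- Maximum principle: a spatially periodic function that is positive initially and satisfies
`∂ₜ w ≥ -C w` at its spatial minima stays positive. -/
theorem pos_of_deriv_ge_at_spatial_min {w : ℝ → ℝ → ℝ} {t₁ C L : ℝ} (hL : 0 < L)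
    (hcont : ContinuousOn (fun p : ℝ × ℝ => w p.1 p.2) (Icc 0 t₁ ×ˢ univ))
    (hper : ∀ t ∈ Icc 0 t₁, Function.Periodic (w t) L)
    (h0 : ∀ φ, 0 < w 0 φ)
    (hd : ∀ t ∈ Icc 0 t₁, ∀ φ ∈ Icc 0 L, (∀ ψ, w t φ ≤ w t ψ) →
      ∃ d, HasDerivAt (fun s => w s φ) d t ∧ -C * w t φ ≤ d) :
    ∀ t ∈ Icc 0 t₁, ∀ φ, 0 < w t φ := by
  by_contra! hneg
  obtain ⟨t, ht, φ, hφ⟩ := hneg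
  have ht₁ : 0 ≤ t₁ := ht.1.trans ht.2
  obtain ⟨φ₀, -, hmin⟩ := isCompact_Icc.exists_isMinOn (nonempty_Icc.2 hL.le)
    (show ContinuousOn (w 0) (Icc 0 L) from
      hcont.comp (f := fun φ => ((0 : ℝ), φ)) (by fun_prop)
        fun φ _ => ⟨left_mem_Icc.2 ht₁, mem_univ _⟩)
  set m := w 0 φ₀ / 2 with hm
  have hmpos : 0 < m := half_pos (h0 φ₀)
  set G : ℝ × ℝ → ℝ := fun p => w p.1 p.2 * exp ((C + 1) * p.1) with hG
  have hGc : ContinuousOn G (Icc 0 t₁ ×ˢ univ) := hcont.mul (by fun_prop)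
  set K : Set (ℝ × ℝ) := Icc 0 t₁ ×ˢ Icc 0 L
  have hK : IsCompact K := isCompact_Icc.prod isCompact_Icc
  have hS : IsCompact (K ∩ G ⁻¹' Iic m) :=
    hK.of_isClosed_subset ((hGc.mono (prod_mono le_rfl (subset_univ _))).preimage_isClosed_of_isClosed
      hK.isClosed isClosed_Iic) inter_subset_left
  have hrep : ∀ s ∈ Icc 0 t₁, ∀ ψ, G (s, ψ) ≤ m →
      ∃ ψ', (s, ψ') ∈ K ∩ G ⁻¹' Iic m := by
    intro s hs ψ h
    obtain ⟨ψ', hψ', heq⟩ := (hper s hs).exists_mem_Ico₀ hL ψ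
    refine ⟨ψ', ⟨hs, Ico_subset_Icc_self hψ'⟩, ?_⟩
    simpa [hG, ← heq] using h
  obtain ⟨ψ, hψ⟩ := hrep t ht φ ((mul_nonpos_of_nonpos_of_nonneg hφ (exp_pos _).le).trans hmpos.le)
  obtain ⟨⟨τ, χ⟩, ⟨⟨hτ, hχ⟩, hle⟩, hfst⟩ := hS.exists_isMinOn ⟨_, hψ⟩ continuous_fst.continuousOn
  simp only [mem_preimage, mem_Iic] at hτ hχ hle
  have hbefore : ∀ s ∈ Ico 0 τ, ∀ ψ, m < G (s, ψ) := by
    intro s hs ψ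
    by_contra! h
    obtain ⟨ψ', h'⟩ := hrep s ⟨hs.1, hs.2.le.trans hτ.2⟩ ψ h
    exact absurd (isMinOn_iff.1 hfst _ h') (not_le.2 hs.2)
  have hτ0 : 0 < τ := by
    refine hτ.1.lt_of_ne ?_
    rintro rfl
    have h1 : w 0 φ₀ ≤ w 0 χ := isMinOn_iff.1 hmin χ hχ
    have h2 : w 0 χ ≤ m := by simpa [hG] using hle
    linarith
  have hIoo : ∀ᶠ s in nhdsWithin τ (Iio τ), s ∈ Ico 0 τ := by
    filter_upwards [Ioo_mem_nhdsLT hτ0] with s hs using ⟨hs.1.le, hs.2⟩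
  have hge : ∀ ψ, m ≤ G (τ, ψ) := by
    intro ψ
    have h1 : ContinuousWithinAt (fun s => G (s, ψ)) (Icc 0 t₁) τ :=
      (hGc (τ, ψ) ⟨hτ, mem_univ _⟩).comp (f := fun s => (s, ψ)) (by fun_prop)
        fun s hs => ⟨hs, mem_univ _⟩
    have h2 : Filter.Tendsto (fun s => G (s, ψ)) (nhdsWithin τ (Iio τ)) (nhds (G (τ, ψ))) :=
      Filter.Tendsto.mono_left h1 (nhdsWithin_le_iff.2
        (hIoo.mono fun s hs => ⟨hs.1, hs.2.le.trans hτ.2⟩))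
    exact ge_of_tendsto h2 (hIoo.mono fun s hs => (hbefore s hs ψ).le)
  have hGm : G (τ, χ) = m := le_antisymm hle (hge χ)
  obtain ⟨d, hdd, hdC⟩ := hd τ hτ χ hχ fun ψ =>
    le_of_mul_le_mul_right (hle.trans (hge ψ)) (exp_pos ((C + 1) * τ))
  have hexp : HasDerivAt (fun s => exp ((C + 1) * s)) (exp ((C + 1) * τ) * (C + 1)) τ := by
    simpa using ((hasDerivAt_id τ).const_mul (C + 1)).exp
  have hGd : HasDerivAt (fun s => G (s, χ)) _ τ := hdd.mul hexp
  have hslope := (hasDerivAt_iff_tendsto_slope.1 hGd).mono_left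
    (nhdsWithin_mono τ (show Iio τ ⊆ {τ}ᶜ from fun s hs => ne_of_lt hs))
  have hnonpos := le_of_tendsto hslope (b := 0) (hIoo.mono fun s hs => by
    rw [slope_def_field]
    exact div_nonpos_of_nonneg_of_nonpos (by linarith [hbefore s hs χ])
      (by linarith [hs.2]))
  have hE := exp_pos ((C + 1) * τ)
  have h3 : w τ χ * exp ((C + 1) * τ) = m := hGm
  nlinarith [mul_le_mul_of_nonneg_right hdC hE.le]

theorem HasDerivAt.im_div_norm {B : ℝ → ℂ} {B' : ℂ} {x : ℝ} (hB : HasDerivAt B B' x)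
    (h0 : B x ≠ 0) :
    HasDerivAt (fun s => (B s).im / ‖B s‖) ((B x).re / ‖B x‖ * (B' / B x).im) x := by
  have him : HasDerivAt (fun s => (B s).im) B'.im x :=
    Complex.imCLM.hasFDerivAt.comp_hasDerivAt x hB
  have hnorm := hB.norm_sq.sqrt (by positivity)
  simp only [Real.sqrt_sq (norm_nonneg _)] at hnorm
  have hn : 0 < ‖B x‖ := norm_pos_iff.2 h0
  refine (him.div hnorm hn.ne').congr_deriv ?_
  have hsq : ‖B x‖ ^ 2 = (B x).re ^ 2 + (B x).im ^ 2 := by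
    rw [← Complex.normSq_eq_norm_sq, Complex.normSq_apply]; ring
  rw [Complex.inner]
  simp only [Complex.div_im, Complex.mul_re, Complex.conj_re, Complex.conj_im,
    Complex.normSq_eq_norm_sq]
  field_simp
  rw [hsq]
  ring

/-- The derivative of a smooth function of two variables in a fixed direction is smooth. -/
theorem ContDiff.fderiv_const_apply {F : ℝ × ℝ → ℂ} (hF : ContDiff ℝ (⊤ : ℕ∞) F) (a : ℝ × ℝ) :
    ContDiff ℝ (⊤ : ℕ∞) (fun p => fderiv ℝ F p a) :=
  (hF.fderiv_right (by simp)).clm_apply contDiff_const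

theorem Differentiable.hasDerivAt_fst {F : ℝ × ℝ → ℂ} (hF : Differentiable ℝ F) (t φ : ℝ) :
    HasDerivAt (fun s => F (s, φ)) (fderiv ℝ F (t, φ) (1, 0)) t :=
  (hF (t, φ)).hasFDerivAt.comp_hasDerivAt t ((hasDerivAt_id t).prodMk (hasDerivAt_const t φ))

theorem Differentiable.hasDerivAt_snd {F : ℝ × ℝ → ℂ} (hF : Differentiable ℝ F) (t φ : ℝ) :
    HasDerivAt (fun ψ => F (t, ψ)) (fderiv ℝ F (t, φ) (0, 1)) φ :=
  (hF (t, φ)).hasFDerivAt.comp_hasDerivAt φ ((hasDerivAt_const φ t).prodMk (hasDerivAt_id φ))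

/-- Symmetry of mixed partial derivatives. -/
theorem ContDiff.hasDerivAt_deriv_swap {F : ℝ × ℝ → ℂ} (hF : ContDiff ℝ (⊤ : ℕ∞) F) (t φ : ℝ) :
    HasDerivAt (fun s => deriv (fun ψ => F (s, ψ)) φ)
      (deriv (fun ψ => deriv (fun s => F (s, ψ)) t) φ) t := by
  have hd : Differentiable ℝ F := hF.differentiable (by simp)
  have hd' : Differentiable ℝ (fderiv ℝ F) := (hF.fderiv_right (m := (⊤ : ℕ∞))
    (by simp)).differentiable (by simp)
  have key : ∀ a b : ℝ × ℝ, fderiv ℝ (fun p => fderiv ℝ F p a) (t, φ) b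
      = fderiv ℝ (fderiv ℝ F) (t, φ) b a := by
    intro a b
    rw [fderiv_clm_apply (hd' _) (differentiableAt_const a)]
    simp
  have hs : IsSymmSndFDerivAt ℝ F (t, φ) := hF.contDiffAt.isSymmSndFDerivAt (by
    simpa using WithTop.coe_le_coe.2 (le_top : (2 : ℕ∞) ≤ ⊤))
  simp only [(hd.hasDerivAt_snd _ _).deriv, (hd.hasDerivAt_fst _ _).deriv]
  have h1 := ((hF.fderiv_const_apply (1, 0)).differentiable (by simp)).hasDerivAt_snd t φ
  have h2 := ((hF.fderiv_const_apply (0, 1)).differentiable (by simp)).hasDerivAt_fst t φ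
  rw [h1.deriv, key, hs.eq, ← key]
  exact h2

theorem ner_eq_im_div_norm (z : ℝ → ℂ) (φ : ℝ) :
    ner z φ = (deriv z φ / z φ).im / ‖deriv z φ / z φ‖ := by
  rcases eq_or_ne (z φ) 0 with h | h
  · simp [ner, h]
  rcases eq_or_ne (deriv z φ) 0 with h' | h'
  · simp [ner, nu, ip, h']
  have h1 : 0 < ‖z φ‖ := norm_pos_iff.2 h
  have h2 : 0 < ‖deriv z φ‖ := norm_pos_iff.2 h'
  simp only [ner, nu, ip, Complex.div_im, norm_div, Complex.normSq_eq_norm_sq, Complex.smul_re,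
    Complex.smul_im, smul_eq_mul]
  field_simp
  ring

/-- The normal speed of the equivariant flow, divided by `|z'|`. -/
noncomputable def normalSpeed (n : ℕ) (z : ℝ → ℂ) (φ : ℝ) : ℝ :=
  ((deriv (deriv z) φ / deriv z φ).im + ((n : ℝ) - 1) * (deriv z φ / z φ).im) /
    Complex.normSq (deriv z φ)

theorem neg_fq_smul_nu (n : ℕ) {z : ℝ → ℂ} {φ : ℝ} (h : z φ ≠ 0) (h' : deriv z φ ≠ 0) :
    -(fq n z φ) • nu z φ = Complex.I * normalSpeed n z φ * deriv z φ := by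
  have h1 : 0 < ‖z φ‖ := norm_pos_iff.2 h
  have h2 : 0 < ‖deriv z φ‖ := norm_pos_iff.2 h'
  have key : fq n z φ = normalSpeed n z φ * ‖deriv z φ‖ := by
    simp only [fq, curv, normalSpeed, ip, nu, Complex.div_im, Complex.normSq_eq_norm_sq,
      Complex.smul_re, Complex.smul_im, smul_eq_mul]
    field_simp
    ring
  rw [key]
  apply Complex.ext
  · simp [nu]
    field_simp
  · simp [nu]
    field_simp

theorem HasDerivAt.normSq {q : ℝ → ℂ} {q' : ℂ} {x : ℝ} (hq : HasDerivAt q q' x)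
    (h0 : q x ≠ 0) :
    HasDerivAt (fun s => Complex.normSq (q s))
      (2 * (q' / q x).re * Complex.normSq (q x)) x := by
  simp only [Complex.normSq_eq_norm_sq]
  refine hq.norm_sq.congr_deriv ?_
  have h2 : 0 < ‖q x‖ := norm_pos_iff.2 h0
  rw [Complex.inner]
  simp only [Complex.div_re, Complex.mul_re, Complex.conj_re, Complex.conj_im,
    Complex.normSq_eq_norm_sq]
  field_simp
  ring

theorem HasDerivAt.complex_im {q : ℝ → ℂ} {q' : ℂ} {x : ℝ} (hq : HasDerivAt q q' x) :
    HasDerivAt (fun s => (q s).im) q'.im x :=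
  Complex.imCLM.hasFDerivAt.comp_hasDerivAt x hq

/-- Pointwise form of the differential inequality at a spatial minimum: `br`, `bi`, `N` stand for
the real part, imaginary part and norm of `z'/z`, `R` for `‖z‖`, and `θ` for the second derivative
of the angle between `ν` and `e_r`. -/
theorem spatial_min_inequality (n : ℕ) {br bi R : ℝ} (hR : 0 < R) {N : ℝ} (hN : 0 < N)
    (hNsq : N ^ 2 = br ^ 2 + bi ^ 2) {θ : ℝ} (hθ : 0 ≤ br / N * θ) :
    -(n / 2 / R ^ 2) * (1 + bi / N) ≤
      br / N * ((θ - 2 * n * br * bi) / (N * R) ^ 2) := by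
  have hb : br ^ 2 = N ^ 2 - bi ^ 2 := by linarith
  have h1 : -N ≤ bi := (abs_le.1 (abs_le_of_sq_le_sq (by nlinarith [sq_nonneg br]) hN.le)).1
  have e : br / N * ((θ - 2 * n * br * bi) / (N * R) ^ 2) + (n / 2 / R ^ 2) * (1 + bi / N)
      = br / N * θ / (N * R) ^ 2 + n * (N + bi) * (N - 2 * bi) ^ 2 / (2 * N ^ 3 * R ^ 2) := by
    field_simp
    linear_combination (-4 * n * bi) * hb
  have : 0 ≤ br / N * θ / (N * R) ^ 2 +
      n * (N + bi) * (N - 2 * bi) ^ 2 / (2 * N ^ 3 * R ^ 2) := by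
    have : 0 ≤ N + bi := by linarith
    positivity
  linarith

/-- At a spatial minimum of `⟨ν, e_r⟩`, the time derivative of `⟨ν, e_r⟩` that the flow prescribes
is at least `-(n / 2) / ‖z‖ ^ 2 * (1 + ⟨ν, e_r⟩)`. -/
theorem ner_deriv_ge_at_min (n : ℕ) {z : ℝ → ℂ} (hz : ContDiff ℝ (⊤ : ℕ∞) z)
    (hnz : ∀ ψ, z ψ ≠ 0) (hreg : ∀ ψ, deriv z ψ ≠ 0) {φ : ℝ}
    (hmin : ∀ ψ, ner z φ ≤ ner z ψ) :
    -(n / 2 / ‖z φ‖ ^ 2) * (1 + ner z φ) ≤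
      (deriv z φ / z φ).re / ‖deriv z φ / z φ‖ *
        ((deriv (fun ψ => Complex.I * normalSpeed n z ψ * deriv z ψ) φ * z φ -
          deriv z φ * (Complex.I * normalSpeed n z φ * deriv z φ)) / z φ ^ 2 /
            (deriv z φ / z φ)).im := by
  have hq : ContDiff ℝ (⊤ : ℕ∞) (deriv z) := (contDiff_infty_iff_deriv.1 hz).2
  have hr : ContDiff ℝ (⊤ : ℕ∞) (deriv (deriv z)) := (contDiff_infty_iff_deriv.1 hq).2
  have dz : ∀ ψ, HasDerivAt z (deriv z ψ) ψ := fun ψ =>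
    (hz.differentiable (by simp) ψ).hasDerivAt
  have dq : ∀ ψ, HasDerivAt (deriv z) (deriv (deriv z) ψ) ψ := fun ψ =>
    (hq.differentiable (by simp) ψ).hasDerivAt
  set A : ℝ → ℂ := fun ψ => deriv (deriv z) ψ / deriv z ψ with hA
  set B : ℝ → ℂ := fun ψ => deriv z ψ / z ψ with hB
  have dA : HasDerivAt A (deriv A φ) φ :=
    ((hr.differentiable (by simp) φ).div (dq φ).differentiableAt (hreg φ)).hasDerivAt
  have dB : ∀ ψ, HasDerivAt B (A ψ * B ψ - B ψ ^ 2) ψ := fun ψ =>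
    ((dq ψ).div (dz ψ) (hnz ψ)).congr_deriv (by
      have := hnz ψ
      have := hreg ψ
      simp only [hA, hB]
      field_simp)
  have hB0 : ∀ ψ, B ψ ≠ 0 := fun ψ => div_ne_zero (hreg ψ) (hnz ψ)
  have hner : ner z = fun ψ => (B ψ).im / ‖B ψ‖ := funext (ner_eq_im_div_norm z)
  have dner : ∀ ψ, HasDerivAt (ner z) ((B ψ).re / ‖B ψ‖ * (A ψ - B ψ).im) ψ := by
    intro ψ
    rw [hner]
    refine ((dB ψ).im_div_norm (hB0 ψ)).congr_deriv ?_
    congr 2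
    have := hB0 ψ
    field_simp
  have hloc : IsLocalMin (ner z) φ := Filter.Eventually.of_forall hmin
  have h1 : (B φ).re / ‖B φ‖ * (A φ - B φ).im = 0 :=
    (dner φ).deriv ▸ hloc.deriv_eq_zero
  have hNpos : 0 < ‖B φ‖ := norm_pos_iff.2 (hB0 φ)
  have hNsq : ‖B φ‖ ^ 2 = (B φ).re ^ 2 + (B φ).im ^ 2 := by
    rw [← Complex.normSq_eq_norm_sq, Complex.normSq_apply]; ring
  have hRpos : 0 < ‖z φ‖ := norm_pos_iff.2 (hnz φ)
  rw [show ner z φ = (B φ).im / ‖B φ‖ from congrFun hner φ]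
  change _ ≤ (B φ).re / ‖B φ‖ * _
  rcases eq_or_ne (B φ).re 0 with hre | hre
  · have := spatial_min_inequality n hRpos hNpos hNsq (θ := 0) (by simp)
    simpa [hre] using this
  have hθ : (A φ - B φ).im = 0 := by
    rcases mul_eq_zero.1 h1 with h | h
    · exact absurd h (div_ne_zero hre hNpos.ne')
    · exact h
  have dθ : HasDerivAt (fun ψ => (A ψ - B ψ).im)
      (deriv A φ - (A φ * B φ - B φ ^ 2)).im φ := (dA.sub (dB φ)).complex_im
  have hθ' : 0 ≤ (B φ).re / ‖B φ‖ * (deriv A φ - (A φ * B φ - B φ ^ 2)).im := by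
    have h2 := hloc.deriv_deriv_nonneg (dner φ).continuousAt
    rw [show deriv (ner z) = fun ψ => (B ψ).re / ‖B ψ‖ * (A ψ - B ψ).im from
      funext fun ψ => (dner ψ).deriv] at h2
    have hsm : DifferentiableAt ℝ (fun ψ => (B ψ).re / ‖B ψ‖) φ :=
      (Complex.reCLM.differentiableAt.comp φ (dB φ).differentiableAt).div
        ((dB φ).differentiableAt.norm ℝ (hB0 φ)) hNpos.ne'
    rw [(hsm.hasDerivAt.fun_mul dθ).deriv, hθ] at h2
    simpa using h2
  refine (spatial_min_inequality n hRpos hNpos hNsq hθ').trans_eq ?_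
  congr 1
  have dS : HasDerivAt (normalSpeed n z) _ φ :=
    (dA.complex_im.add ((dB φ).complex_im.const_mul ((n : ℝ) - 1))).div ((dq φ).normSq (hreg φ))
      (Complex.normSq_pos.2 (hreg φ)).ne'
  have dV := (dS.ofReal_comp.const_mul Complex.I).mul (dq φ)
  rw [HasDerivAt.deriv (f := fun ψ => Complex.I * normalSpeed n z ψ * deriv z ψ) dV]
  have hg : Complex.normSq (deriv z φ) = (‖B φ‖ * ‖z φ‖) ^ 2 := by
    rw [← norm_mul, Complex.normSq_eq_norm_sq, div_mul_cancel₀ _ (hnz φ)]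
  have hr' : deriv (deriv z) φ = A φ * deriv z φ := (div_mul_cancel₀ _ (hreg φ)).symm
  have hAim : (A φ).im = (B φ).im := by simpa [sub_eq_zero] using hθ
  have hsp : normalSpeed n z φ = n * (B φ).im / (‖B φ‖ * ‖z φ‖) ^ 2 := by
    rw [← hg, normalSpeed]
    change ((A φ).im + _ * (B φ).im) / _ = _
    rw [hAim]; ring
  have hquot : ∀ s s' : ℝ, ((Complex.I * s' * deriv z φ + Complex.I * s * deriv (deriv z) φ) * z φ -
      deriv z φ * (Complex.I * s * deriv z φ)) / z φ ^ 2 / (deriv z φ / z φ) =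
      Complex.I * (s' + s * (A φ - B φ)) := by
    intro s s'
    have := hnz φ
    have := hreg φ
    rw [hr']
    simp only [hB]
    field_simp
    ring
  rw [hquot]
  change _ = (Complex.I * (((_ * Complex.normSq (deriv z φ) -
    ((A φ).im + ((n : ℝ) - 1) * (B φ).im) * (2 * (A φ).re * Complex.normSq (deriv z φ))) /
      Complex.normSq (deriv z φ) ^ 2 : ℝ) + _)).im
  rw [hsp, hg]
  have := hNpos.ne'
  have := hRpos.ne'
  simp only [Complex.mul_im, Complex.I_re, Complex.I_im, Complex.add_re, Complex.ofReal_re,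
    Complex.mul_re, Complex.ofReal_im, Complex.sub_re, Complex.sub_im, pow_two (B φ), hAim]
  field_simp
  ring

/-- Austereness (⟨ν,e_r⟩ > −1) is preserved under the equivariant flow. -/
theorem austere_preserved (n : ℕ) (hn : 1 ≤ n) (T : ℝ) (z : ℝ → ℝ → ℂ)
    (hsm : ContDiff ℝ (⊤ : ℕ∞) (fun p : ℝ × ℝ => z p.1 p.2))
    (hper : ∀ t φ, z t (φ + 2 * π) = z t φ)
    (hreg : ∀ t ∈ Ico (0:ℝ) T, ∀ φ, deriv (z t) φ ≠ 0)
    (hnz : ∀ t ∈ Ico (0:ℝ) T, ∀ φ, z t φ ≠ 0)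
    (hflow : ∀ t ∈ Ico (0:ℝ) T, ∀ φ,
      deriv (fun s => z s φ) t = -(fq n (z t) φ) • nu (z t) φ)
    (haustere : ∀ φ : ℝ, -1 < ner (z 0) φ) :
    ∀ t ∈ Ico (0:ℝ) T, ∀ φ : ℝ, -1 < ner (z t) φ := by
  intro t₁ ht₁
  have hJ : ∀ t ∈ Icc 0 t₁, t ∈ Ico 0 T := fun t ht => ⟨ht.1, ht.2.trans_lt ht₁.2⟩
  have hdF : Differentiable ℝ (fun p : ℝ × ℝ => z p.1 p.2) := hsm.differentiable (by simp)
  have hderiv : ∀ t φ, deriv (z t) φ = fderiv ℝ (fun p : ℝ × ℝ => z p.1 p.2) (t, φ) (0, 1) :=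
    fun t φ => (hdF.hasDerivAt_snd t φ).deriv
  have hslice : ∀ t, ContDiff ℝ (⊤ : ℕ∞) (z t) := fun t =>
    hsm.comp (contDiff_const.prodMk contDiff_id)
  have hz1 : Continuous (fun p : ℝ × ℝ => deriv (z p.1) p.2) := by
    simp only [hderiv]
    exact (hsm.fderiv_const_apply (0, 1)).continuous
  obtain ⟨C, hC⟩ := (isCompact_Icc.prod isCompact_Icc).bddAbove_image
    (f := fun p : ℝ × ℝ => (n : ℝ) / 2 / ‖z p.1 p.2‖ ^ 2) (K := Icc 0 t₁ ×ˢ Icc 0 (2 * π))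
    (continuousOn_const.div (hsm.continuous.norm.pow 2).continuousOn fun p hp =>
      pow_ne_zero 2 (norm_ne_zero_iff.2 (hnz _ (hJ _ hp.1) _)))
  have hpos := pos_of_deriv_ge_at_spatial_min (w := fun t φ => 1 + ner (z t) φ) (t₁ := t₁) (C := C)
    two_pi_pos ?_ ?_ (fun φ => by linarith [haustere φ]) ?_
  · intro φ
    linarith [hpos t₁ (right_mem_Icc.2 ht₁.1) φ]
  · simp only [ner_eq_im_div_norm]
    have hB : ContinuousOn (fun p : ℝ × ℝ => deriv (z p.1) p.2 / z p.1 p.2)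
        (Icc 0 t₁ ×ˢ univ) :=
      hz1.continuousOn.div hsm.continuous.continuousOn fun p hp => hnz _ (hJ _ hp.1) _
    exact continuousOn_const.add ((Complex.continuous_im.comp_continuousOn hB).div hB.norm
      fun p hp => norm_ne_zero_iff.2
        (div_ne_zero (hreg _ (hJ _ hp.1) _) (hnz _ (hJ _ hp.1) _)))
  · intro t _ φ
    have : deriv (z t) (φ + 2 * π) = deriv (z t) φ := by
      rw [← deriv_comp_add_const, funext (hper t)]
    simp only [ner_eq_im_div_norm, this, hper]
  · intro t ht φ hφ hmin
    have htT := hJ t ht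
    have hvel : ∀ ψ, deriv (fun s => z s ψ) t =
        Complex.I * normalSpeed n (z t) ψ * deriv (z t) ψ := fun ψ =>
      (hflow t htT ψ).trans (neg_fq_smul_nu n (hnz t htT ψ) (hreg t htT ψ))
    have h1 : HasDerivAt (fun s => z s φ)
        (Complex.I * normalSpeed n (z t) φ * deriv (z t) φ) t :=
      hvel φ ▸ (hdF.hasDerivAt_fst t φ).differentiableAt.hasDerivAt
    have h2 : HasDerivAt (fun s => deriv (z s) φ)
        (deriv (fun ψ => Complex.I * normalSpeed n (z t) ψ * deriv (z t) ψ) φ) t :=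
      funext hvel ▸ hsm.hasDerivAt_deriv_swap t φ
    have hB : HasDerivAt (fun s => deriv (z s) φ / z s φ) _ t := h2.div h1 (hnz t htT φ)
    have hw := (hB.im_div_norm (div_ne_zero (hreg t htT φ) (hnz t htT φ))).const_add 1
    refine ⟨_, by simpa only [ner_eq_im_div_norm] using hw, ?_⟩
    refine le_trans ?_ (ner_deriv_ge_at_min n (hslice t) (hnz t htT) (hreg t htT)
      fun ψ => by linarith [hmin ψ])
    have hCt : (n : ℝ) / 2 / ‖z t φ‖ ^ 2 ≤ C := hC ⟨(t, φ), ⟨ht, hφ⟩, rfl⟩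
    have hge : 0 ≤ 1 + ner (z t) φ := by
      rw [ner_eq_im_div_norm]
      have := (abs_le.1 (Complex.abs_im_div_norm_le_one (deriv (z t) φ / z t φ))).1
      linarith
    exact mul_le_mul_of_nonneg_right (neg_le_neg hCt) hge
end
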